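/- Let ε > 0, γ > 0, δ ≥ 0, M ≥ 0, T > 0, and let ρ : [0,T] → [0,∞) be continuous. Let b : ℝ³×[0,T] → ℝ³ be smooth, ℤ³-periodic in space, divergence-free, with |b(x,t)| + |(∇b)(x,t)| ≤ M for all (x,t). Let σ : ℝ³×[0,T] → M₃(ℝ) be smooth, ℤ³-periodic in space, satisfying pointwise ∂ₜσ = εΔσ − (b·∇)σ + (∇b)σ + σ(∇b)ᵀ − γσ + δI, and suppose ‖σ(·,t)‖²_{L²} ≤ ρ(t) for all t ∈ [0,T]. Then for all t ∈ [0,T], ‖∇σ(·,t)‖²_{L²} ≤ e^{2M²t/ε} ( ‖∇σ(·,0)‖²_{L²} + (2δ²/ε) t + ((2γ² + 8M²)/ε) ∫₀ᵗ ρ(s) ds ). -/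

import Mathlib

open MeasureTheory

noncomputable section

abbrev V3 := Fin 3 → ℝ

/-- spatial partial derivative ∂ᵢf -/
def pd (i : Fin 3) (f : V3 → ℝ) (x : V3) : ℝ := fderiv ℝ f x (Pi.single i 1)

/-- Laplacian of a scalar function -/
def lap (f : V3 → ℝ) (x : V3) : ℝ := ∑ i, pd i (pd i f) x

/-- ℤ³-periodicity -/
def Periodic3 (f : V3 → ℝ) : Prop :=
  ∀ (x : V3) (k : Fin 3 → ℤ), f (x + fun i => (k i : ℝ)) = f x

/-- mollification Jf = η ∗ f -/
def J3 (η f : V3 → ℝ) (x : V3) : ℝ := ∫ y, η (x - y) * f y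

/-- curl ∇×u -/
def curl3 (u : V3 → V3) (x : V3) : V3 :=
  ![pd 1 (fun y => u y 2) x - pd 2 (fun y => u y 1) x,
    pd 2 (fun y => u y 0) x - pd 0 (fun y => u y 2) x,
    pd 0 (fun y => u y 1) x - pd 1 (fun y => u y 0) x]

/-- (v·∇)u -/
def advect (v u : V3 → V3) (x : V3) : V3 :=
  fun i => ∑ j, v x j * pd j (fun y => u y i) x

/-- the bilinear term Ω(v,u) -/
def Omg (v u : V3 → V3) (x : V3) : V3 :=
  ![∑ j, (pd 1 (fun y => v y j) x * pd j (fun y => u y 2) x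
      - pd 2 (fun y => v y j) x * pd j (fun y => u y 1) x),
    ∑ j, (pd 2 (fun y => v y j) x * pd j (fun y => u y 0) x
      - pd 0 (fun y => v y j) x * pd j (fun y => u y 2) x),
    ∑ j, (pd 0 (fun y => v y j) x * pd j (fun y => u y 1) x
      - pd 1 (fun y => v y j) x * pd j (fun y => u y 0) x)]

theorem integral_pd_eq_zero (f : V3 → ℝ) (hf : ContDiff ℝ 1 f) (hper : Periodic3 f) (k : Fin 3) :
    ∫ x in Set.Icc (0 : V3) 1, pd k f x = 0 := by
  have hd : Differentiable ℝ f := hf.differentiable one_ne_zero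
  have hpd : Continuous (pd k f) :=
    (hf.continuous_fderiv one_ne_zero).clm_apply continuous_const
  have hl : (fun x => ∑ i, (if i = k then fderiv ℝ f else 0) x (Pi.single i 1)) = pd k f := by
    funext x
    rw [Finset.sum_eq_single k]
    · simp [pd]
    · intro i _ h; simp [h]
    · simp
  have key := integral_divergence_of_hasFDerivAt_off_countable' (n := 2) (E := ℝ) (0 : V3) 1
    (by intro i; simp) (fun i => if i = k then f else 0)
    (fun i => if i = k then fderiv ℝ f else 0) ∅ Set.countable_empty
    (by
      intro i
      by_cases h : i = k
      · simpa [h] using hf.continuous.continuousOn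
      · simp only [h, if_false]
        exact continuousOn_const)
    (by
      intro x _ i
      by_cases h : i = k
      · simpa [h] using (hd x).hasFDerivAt
      · simp only [h, if_false]
        exact hasFDerivAt_const (0 : ℝ) x)
    (by
      rw [hl]
      exact hpd.continuousOn.integrableOn_compact isCompact_Icc)
  rw [hl] at key
  rw [key]
  refine Finset.sum_eq_zero fun i _ => ?_
  by_cases h : i = k
  · subst h
    simp only [if_true, Pi.one_apply, Pi.zero_apply]
    rw [sub_eq_zero]
    congr 1
    funext x
    have := hper (Fin.insertNth i (0 : ℝ) x) (Pi.single i 1)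
    rw [← this]
    congr 1
    funext j
    refine Fin.succAboveCases i ?_ (fun l => ?_) j
    · simp
    · simp
  · simp [h]

/-- Differentiation in the time variable of an integral over the unit cube. -/
theorem hasDerivAt_integral_cube (F : V3 × ℝ → ℝ) (hF : ContDiff ℝ 1 F) (t : ℝ) :
    HasDerivAt (fun s => ∫ x in Set.Icc (0 : V3) 1, F (x, s))
      (∫ x in Set.Icc (0 : V3) 1, fderiv ℝ F (x, t) (0, 1)) t := by
  have hc : Continuous fun q : V3 × ℝ => fderiv ℝ F q (0, 1) :=
    (hF.continuous_fderiv one_ne_zero).clm_apply continuous_const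
  obtain ⟨C, hC⟩ := ((isCompact_Icc (a := (0 : V3)) (b := 1)).prod
    (isCompact_closedBall t 1)).exists_bound_of_continuousOn hc.continuousOn
  refine (hasDerivAt_integral_of_dominated_loc_of_deriv_le
    (F := fun s x => F (x, s)) (F' := fun s x => fderiv ℝ F (x, s) (0, 1))
    (bound := fun _ => C) (Metric.ball_mem_nhds t one_pos) ?_ ?_ ?_ ?_ ?_ ?_).2
  · refine Filter.Eventually.of_forall fun s => ?_
    exact (hF.continuous.comp (by fun_prop : Continuous fun x : V3 => (x, s))).aestronglyMeasurable
  · exact (hF.continuous.comp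
      (by fun_prop : Continuous fun x : V3 => (x, t))).continuousOn.integrableOn_compact isCompact_Icc
  · exact (hc.comp (by fun_prop : Continuous fun x : V3 => (x, t))).aestronglyMeasurable
  · filter_upwards [ae_restrict_mem measurableSet_Icc] with x hx s hs
    exact hC (x, s) ⟨hx, Metric.ball_subset_closedBall hs⟩
  · exact (continuous_const.continuousOn (s := Set.Icc (0 : V3) 1)).integrableOn_compact isCompact_Icc
  · refine Filter.Eventually.of_forall fun x s _ => ?_
    have h1 := (hF.differentiable one_ne_zero (x, s)).hasFDerivAt
    exact h1.comp_hasDerivAt s ((hasDerivAt_const s x).prodMk (hasDerivAt_id s))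

theorem pd_slice (F : V3 × ℝ → ℝ) (hF : Differentiable ℝ F) (k : Fin 3) (x : V3) (t : ℝ) :
    pd k (fun y => F (y, t)) x = fderiv ℝ F (x, t) (Pi.single k 1, 0) := by
  have h : HasFDerivAt (fun y : V3 => (y, t)) _ x :=
    (hasFDerivAt_id (𝕜 := ℝ) x).prodMk (hasFDerivAt_const t x)
  have h' : HasFDerivAt (fun y => F (y, t)) _ x := (hF (x, t)).hasFDerivAt.comp x h
  rw [pd, h'.fderiv]
  simp

theorem contDiff_fderiv_apply {E : Type*} [NormedAddCommGroup E] [NormedSpace ℝ E] {F : E → ℝ}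
    (hF : ContDiff ℝ (⊤ : ℕ∞) F) (v : E) : ContDiff ℝ (⊤ : ℕ∞) fun q => fderiv ℝ F q v :=
  (hF.fderiv_right (m := (⊤ : ℕ∞)) (by simp)).clm_apply contDiff_const

theorem fderiv_fderiv_apply_comm {E : Type*} [NormedAddCommGroup E] [NormedSpace ℝ E] {F : E → ℝ}
    (hF : ContDiff ℝ (⊤ : ℕ∞) F) (v w q : E) :
    fderiv ℝ (fun p => fderiv ℝ F p v) q w = fderiv ℝ (fun p => fderiv ℝ F p w) q v := by
  have hd : DifferentiableAt ℝ (fderiv ℝ F) q :=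
    (hF.fderiv_right (m := (⊤ : ℕ∞)) (by simp)).differentiable (by simp) q
  have hs : IsSymmSndFDerivAt ℝ F q :=
    hF.contDiffAt.isSymmSndFDerivAt (by simpa using WithTop.coe_le_coe.2 (le_top (a := (2 : ℕ∞))))
  rw [fderiv_clm_apply hd (differentiableAt_const v), fderiv_clm_apply hd (differentiableAt_const w)]
  simpa using hs w v

theorem frobenius_mul_le {ι : Type*} [Fintype ι] (A B : ι → ι → ℝ) :
    ∑ i, ∑ j, (∑ k, A i k * B k j) ^ 2 ≤ (∑ i, ∑ k, A i k ^ 2) * ∑ k, ∑ j, B k j ^ 2 := by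
  calc ∑ i, ∑ j, (∑ k, A i k * B k j) ^ 2
      ≤ ∑ i, ∑ j, (∑ k, A i k ^ 2) * ∑ k, B k j ^ 2 := by
        gcongr; exact Finset.sum_mul_sq_le_sq_mul_sq _ _ _
    _ = _ := by
        rw [Finset.sum_comm (f := fun k j => B k j ^ 2), Finset.sum_mul_sum]

theorem dissipation_bound (ε γ δ M : ℝ) (hε : 0 < ε) (β : Fin 3 → ℝ) (B S L f : Fin 3 → Fin 3 → ℝ)
    (G : Fin 3 → Fin 3 → Fin 3 → ℝ)
    (hM : √(∑ i, β i ^ 2) + √(∑ i, ∑ j, B i j ^ 2) ≤ M)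
    (hf : ∀ i j, f i j = ε * L i j - (∑ k, β k * G i j k) + (∑ k, B i k * S k j)
      + (∑ k, S i k * B j k) - γ * S i j + δ * (if i = j then (1 : ℝ) else 0)) :
    -2 * ∑ i, ∑ j, L i j * f i j ≤ 2 * M ^ 2 / ε * (∑ i, ∑ j, ∑ k, G i j k ^ 2)
      + (2 * γ ^ 2 + 8 * M ^ 2) / ε * (∑ i, ∑ j, S i j ^ 2) - 2 * δ * ∑ i, L i i := by
  have hβ : ∑ i, β i ^ 2 ≤ M ^ 2 :=
    (Real.sqrt_le_left ((add_nonneg (Real.sqrt_nonneg _) (Real.sqrt_nonneg _)).trans hM)).1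
      (by linarith [Real.sqrt_nonneg (∑ i, ∑ j, B i j ^ 2)])
  have hB : ∑ i, ∑ j, B i j ^ 2 ≤ M ^ 2 :=
    (Real.sqrt_le_left ((add_nonneg (Real.sqrt_nonneg _) (Real.sqrt_nonneg _)).trans hM)).1
      (by linarith [Real.sqrt_nonneg (∑ i, β i ^ 2)])
  have hS0 : 0 ≤ ∑ i, ∑ j, S i j ^ 2 := by positivity
  have hG0 : 0 ≤ ∑ i, ∑ j, ∑ k, G i j k ^ 2 := by positivity
  have hA : ∑ i, ∑ j, (∑ k, β k * G i j k) ^ 2 ≤ M ^ 2 * ∑ i, ∑ j, ∑ k, G i j k ^ 2 := by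
    calc _ ≤ ∑ i, ∑ j, (∑ k, β k ^ 2) * ∑ k, G i j k ^ 2 := by
          gcongr; exact Finset.sum_mul_sq_le_sq_mul_sq _ _ _
      _ = (∑ k, β k ^ 2) * ∑ i, ∑ j, ∑ k, G i j k ^ 2 := by simp only [Finset.mul_sum]
      _ ≤ _ := by gcongr
  have hP : ∑ i, ∑ j, (∑ k, B i k * S k j) ^ 2 ≤ M ^ 2 * ∑ i, ∑ j, S i j ^ 2 :=
    (frobenius_mul_le B S).trans (by gcongr)
  have hQ : ∑ i, ∑ j, (∑ k, S i k * B j k) ^ 2 ≤ M ^ 2 * ∑ i, ∑ j, S i j ^ 2 := by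
    refine (frobenius_mul_le S fun k j => B j k).trans ?_
    rw [Finset.sum_comm (f := fun k j => B j k ^ 2), mul_comm]
    gcongr
  have hpt : ∀ i j, -2 * (L i j * f i j) ≤ 3 / (2 * ε) * (∑ k, β k * G i j k) ^ 2
      + 3 / ε * (∑ k, B i k * S k j) ^ 2 + 3 / ε * (∑ k, S i k * B j k) ^ 2
      + 3 / (2 * ε) * (γ ^ 2 * S i j ^ 2) - 2 * δ * (if i = j then L i j else 0) := by
    intro i j
    rw [hf]
    generalize (∑ k, β k * G i j k) = a
    generalize (∑ k, B i k * S k j) = p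
    generalize (∑ k, S i k * B j k) = q
    have h : 3 / (2 * ε) * a ^ 2 + 3 / ε * p ^ 2 + 3 / ε * q ^ 2 + 3 / (2 * ε) * (γ ^ 2 * S i j ^ 2)
        - -2 * (L i j * (ε * L i j - a + p + q - γ * S i j)) =
        1 / (2 * ε) * (3 * a ^ 2 + 6 * p ^ 2 + 6 * q ^ 2 + 3 * (γ * S i j) ^ 2
          + 4 * (ε * L i j) * (ε * L i j - a + p + q - γ * S i j)) := by
      field_simp
      ring
    have h0 : 0 ≤ 3 * a ^ 2 + 6 * p ^ 2 + 6 * q ^ 2 + 3 * (γ * S i j) ^ 2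
          + 4 * (ε * L i j) * (ε * L i j - a + p + q - γ * S i j) := by
      nlinarith [sq_nonneg (2 * (ε * L i j) - a + (p + q) - γ * S i j), sq_nonneg (a + (p + q)),
        sq_nonneg (a - γ * S i j), sq_nonneg (p + q + γ * S i j), sq_nonneg (p - q)]
    have h1 := mul_nonneg (by positivity : 0 ≤ 1 / (2 * ε)) h0
    rw [← h] at h1
    split_ifs <;> linarith
  have hsum := Finset.sum_le_sum fun i (_ : i ∈ Finset.univ) =>
    Finset.sum_le_sum fun j (_ : j ∈ Finset.univ) => hpt i j
  simp only [Finset.sum_add_distrib, Finset.sum_sub_distrib, ← Finset.mul_sum, Finset.sum_ite_eq,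
    Finset.mem_univ, if_true] at hsum
  refine hsum.trans ?_
  generalize (∑ i, ∑ j, ∑ k, G i j k ^ 2) = X at *
  generalize (∑ i, ∑ j, S i j ^ 2) = Y at *
  generalize (∑ i, ∑ j, (∑ k, β k * G i j k) ^ 2) = a at *
  generalize (∑ i, ∑ j, (∑ k, B i k * S k j) ^ 2) = p at *
  generalize (∑ i, ∑ j, (∑ k, S i k * B j k) ^ 2) = q at *
  have e : 0 ≤ 1 / (2 * ε) * (M ^ 2 * X + (γ ^ 2 + 4 * M ^ 2) * Y + 3 * (M ^ 2 * X - a)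
      + 6 * (M ^ 2 * Y - p) + 6 * (M ^ 2 * Y - q)) := by
    have := sub_nonneg.2 hA
    have := sub_nonneg.2 hP
    have := sub_nonneg.2 hQ
    positivity
  rw [← sub_nonneg]
  refine e.trans_eq ?_
  field_simp
  ring

theorem le_exp_mul_of_deriv_le {y y' ρ : ℝ → ℝ} {a c T : ℝ} (ha : 0 ≤ a) (hc : 0 ≤ c)
    (hy : ∀ t, HasDerivAt y (y' t) t) (hρc : ContinuousOn ρ (Set.Icc 0 T))
    (hρ0 : ∀ t ∈ Set.Icc 0 T, 0 ≤ ρ t)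
    (hle : ∀ t ∈ Set.Icc 0 T, y' t ≤ a * y t + c * ρ t) :
    ∀ t ∈ Set.Icc 0 T, y t ≤ Real.exp (a * t) * (y 0 + c * ∫ s in (0 : ℝ)..t, ρ s) := by
  intro t ht
  have hT : 0 ≤ T := ht.1.trans ht.2
  have hcy : Continuous y := continuous_iff_continuousAt.2 fun s => (hy s).continuousAt
  have hexp : ∀ s, HasDerivAt (fun s => Real.exp (-a * s)) (Real.exp (-a * s) * (-a)) s := fun s => by
    simpa using ((hasDerivAt_id s).const_mul (-a)).exp
  have hz : ∀ s ∈ Set.Ioo 0 T, HasDerivAt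
      (fun s => Real.exp (-a * s) * y s - c * ∫ r in (0 : ℝ)..s, ρ r)
      (Real.exp (-a * s) * (-a) * y s + Real.exp (-a * s) * y' s - c * ρ s) s := by
    intro s hs
    refine ((hexp s).mul (hy s)).sub (HasDerivAt.const_mul c ?_)
    refine intervalIntegral.integral_hasDerivAt_right ?_ ?_ ?_
    · refine (hρc.mono ?_).intervalIntegrable
      rw [Set.uIcc_of_le hs.1.le]
      exact Set.Icc_subset_Icc_right hs.2.le
    · exact (hρc.mono Set.Ioo_subset_Icc_self).stronglyMeasurableAtFilter isOpen_Ioo s hs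
    · exact hρc.continuousAt (Icc_mem_nhds hs.1 hs.2)
  have hanti : AntitoneOn (fun s => Real.exp (-a * s) * y s - c * ∫ r in (0 : ℝ)..s, ρ r)
      (Set.Icc 0 T) := by
    refine antitoneOn_of_deriv_nonpos (convex_Icc 0 T) ?_ ?_ ?_
    · refine ContinuousOn.sub (by fun_prop) (continuousOn_const.mul ?_)
      have := intervalIntegral.continuousOn_primitive_interval (μ := MeasureTheory.volume) (f := ρ) (a := 0) (b := T)
        (by rw [Set.uIcc_of_le hT]; exact hρc.integrableOn_Icc)
      rwa [Set.uIcc_of_le hT] at this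
    · rw [interior_Icc]
      exact fun s hs => (hz s hs).differentiableAt.differentiableWithinAt
    · rw [interior_Icc]
      intro s hs
      rw [(hz s hs).deriv]
      have hs' := Set.Ioo_subset_Icc_self hs
      have h1 : Real.exp (-a * s) ≤ 1 := Real.exp_le_one_iff.2 (by nlinarith [hs'.1])
      have h2 := mul_le_mul_of_nonneg_left (hle s hs') (Real.exp_pos (-a * s)).le
      have h3 := mul_le_mul_of_nonneg_right h1 (mul_nonneg hc (hρ0 s hs'))
      linarith
  have h := hanti ⟨le_rfl, hT⟩ ht ht.1
  simp only [mul_zero, Real.exp_zero, one_mul, intervalIntegral.integral_same, sub_zero] at h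
  have h' : Real.exp (-a * t) * y t ≤ y 0 + c * ∫ s in (0 : ℝ)..t, ρ s := by linarith
  calc y t = Real.exp (a * t) * (Real.exp (-a * t) * y t) := by
        rw [← mul_assoc, ← Real.exp_add]; simp
    _ ≤ _ := by gcongr


theorem Periodic3.pd {f : V3 → ℝ} (hf : Periodic3 f) (k : Fin 3) : Periodic3 (pd k f) := by
  intro x m
  have h : (fun y => f (y + fun i => (m i : ℝ))) = f := funext fun y => hf y m
  simp only [_root_.pd]
  rw [← fderiv_comp_add_right, h]

theorem contDiff_pd {f : V3 → ℝ} (hf : ContDiff ℝ (⊤ : ℕ∞) f) (k : Fin 3) :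
    ContDiff ℝ (⊤ : ℕ∞) (pd k f) :=
  contDiff_fderiv_apply hf _

theorem continuous_lap {f : V3 → ℝ} (hf : ContDiff ℝ (⊤ : ℕ∞) f) : Continuous (lap f) :=
  continuous_finsetSum _ fun k _ => (contDiff_pd (contDiff_pd hf k) k).continuous

theorem integral_lap_eq_zero {f : V3 → ℝ} (hf : ContDiff ℝ (⊤ : ℕ∞) f) (hper : Periodic3 f) :
    ∫ x in Set.Icc (0 : V3) 1, lap f x = 0 := by
  simp only [lap]
  rw [integral_finsetSum _ fun k _ => (contDiff_pd (contDiff_pd hf k)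
    k).continuous.continuousOn.integrableOn_compact isCompact_Icc]
  exact Finset.sum_eq_zero fun k _ => integral_pd_eq_zero _
    ((contDiff_pd hf k).of_le (by exact_mod_cast le_top)) (hper.pd k) k

/-- Green's identity on the torus. -/
theorem integral_sum_pd_mul_pd {f g : V3 → ℝ} (hf : ContDiff ℝ (⊤ : ℕ∞) f)
    (hg : ContDiff ℝ (⊤ : ℕ∞) g) (hfper : Periodic3 f) (hgper : Periodic3 g) :
    ∫ x in Set.Icc (0 : V3) 1, ∑ k, pd k f x * pd k g x =
      -∫ x in Set.Icc (0 : V3) 1, lap f x * g x := by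
  have hpd : ∀ k x, pd k (fun y => pd k f y * g y) x = pd k f x * pd k g x + pd k (pd k f) x * g x := by
    intro k x
    have h1 := (contDiff_pd hf k).differentiable (by simp) x
    have h2 := hg.differentiable (by simp) x
    rw [pd, fderiv_fun_mul h1 h2]
    simp [pd, mul_comm]
  have hsm : ∀ k, ContDiff ℝ (⊤ : ℕ∞) fun y => pd k f y * g y := fun k => (contDiff_pd hf k).mul hg
  have hz : ∫ x in Set.Icc (0 : V3) 1, ∑ k, pd k (fun y => pd k f y * g y) x = 0 := by
    rw [integral_finsetSum _ fun k _ => (contDiff_pd (hsm k)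
      k).continuous.continuousOn.integrableOn_compact isCompact_Icc]
    exact Finset.sum_eq_zero fun k _ => integral_pd_eq_zero _ ((hsm k).of_le (by exact_mod_cast le_top))
      (fun x m => by simp only [hfper.pd k x m, hgper x m]) k
  rw [eq_neg_iff_add_eq_zero, ← integral_add, ← hz]
  · simp only [hpd, lap, Finset.sum_add_distrib, Finset.sum_mul]
  · exact (continuous_finsetSum _ fun k _ => (contDiff_pd hf k).continuous.mul
      (contDiff_pd hg k).continuous).continuousOn.integrableOn_compact isCompact_Icc
  · exact ((continuous_lap hf).mul hg.continuous).continuousOn.integrableOn_compact isCompact_Icc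

/-- Time derivative of the Dirichlet energy of a spatially periodic function. -/
theorem hasDerivAt_dirichlet_energy {F : V3 × ℝ → ℝ} (hF : ContDiff ℝ (⊤ : ℕ∞) F)
    (hper : ∀ t, Periodic3 fun x => F (x, t)) (t : ℝ) :
    HasDerivAt (fun s => ∫ x in Set.Icc (0 : V3) 1, ∑ k, (pd k (fun y => F (y, s)) x) ^ 2)
      (-2 * ∫ x in Set.Icc (0 : V3) 1, lap (fun y => F (y, t)) x * fderiv ℝ F (x, t) (0, 1)) t := by
  have hd : Differentiable ℝ F := hF.differentiable (by simp)
  have hDt := contDiff_fderiv_apply hF (0, 1)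
  have hslice : ContDiff ℝ (⊤ : ℕ∞) fun x : V3 => (x, t) := contDiff_id.prodMk contDiff_const
  have hDper : Periodic3 fun x => fderiv ℝ F (x, t) (0, 1) := by
    intro x m
    have h : (fun q => F (q + ((fun i => (m i : ℝ)), 0))) = F := by
      funext q
      convert hper q.2 q.1 m using 2
      simp [Prod.ext_iff]
    have h' := fderiv_comp_add_right (𝕜 := ℝ) (f := F) (x := (x, t)) ((fun i => (m i : ℝ)), (0 : ℝ))
    rw [h] at h'
    simp [h']
  simp only [fun s k x => pd_slice F hd k x s]
  have hDk : ∀ k : Fin 3, ContDiff ℝ (⊤ : ℕ∞) fun q => fderiv ℝ F q (Pi.single k 1, 0) :=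
    fun k => contDiff_fderiv_apply hF _
  have hΦ : ContDiff ℝ 1 fun q => ∑ k : Fin 3, (fderiv ℝ F q (Pi.single k 1, 0)) ^ 2 :=
    (ContDiff.sum fun k _ => (hDk k).pow 2).of_le (by exact_mod_cast le_top)
  have key := hasDerivAt_integral_cube _ hΦ t
  have hpt : ∀ x : V3, fderiv ℝ (fun q => ∑ k : Fin 3, (fderiv ℝ F q (Pi.single k 1, 0)) ^ 2)
      (x, t) (0, 1) = 2 * ∑ k, pd k (fun y => F (y, t)) x *
        pd k (fun y => fderiv ℝ F (y, t) (0, 1)) x := by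
    intro x
    have hdk : ∀ k : Fin 3, DifferentiableAt ℝ (fun q => fderiv ℝ F q (Pi.single k 1, 0)) (x, t) :=
      fun k => (hDk k).differentiable (by simp) _
    rw [fderiv_fun_sum fun k _ => (hdk k).fun_pow 2, _root_.sum_apply, Finset.mul_sum]
    refine Finset.sum_congr rfl fun k _ => ?_
    rw [pd_slice F hd, pd_slice _ (hDt.differentiable (by simp)), fderiv_fderiv_apply_comm hF (0, 1),
      fderiv_fun_pow _ (hdk k)]
    simp [mul_assoc]
  simp only [hpt] at key
  have hgreen := integral_sum_pd_mul_pd (f := fun x => F (x, t))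
    (g := fun x => fderiv ℝ F (x, t) (0, 1)) (hF.comp hslice) (hDt.comp hslice) (hper t) hDper
  rwa [integral_const_mul, hgreen, mul_neg, ← neg_mul] at key

/-- L² a priori estimate for ∇σ in the diffusive case ε > 0. -/
theorem grad_sigma_L2_apriori (ε γ δ M T : ℝ)
    (hε : 0 < ε) (hγ : 0 < γ) (hδ : 0 ≤ δ) (hM : 0 ≤ M) (hT : 0 < T)
    (ρ : ℝ → ℝ) (hρc : ContinuousOn ρ (Set.Icc (0:ℝ) T))
    (hρ0 : ∀ t ∈ Set.Icc (0:ℝ) T, 0 ≤ ρ t)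
    (b : V3 → ℝ → V3) (σ : V3 → ℝ → Matrix (Fin 3) (Fin 3) ℝ)
    (hb : ∀ i, ContDiff ℝ (⊤:ℕ∞) (fun q : V3 × ℝ => b q.1 q.2 i))
    (hbper : ∀ t i, Periodic3 (fun x => b x t i))
    (hbdiv : ∀ (x : V3) (t : ℝ), (∑ i, pd i (fun y => b y t i) x) = 0)
    (hbbound : ∀ (x : V3) (t : ℝ),
      Real.sqrt (∑ i, (b x t i)^2)
        + Real.sqrt (∑ i, ∑ j, (pd j (fun y => b y t i) x)^2) ≤ M)
    (hσ : ∀ i j, ContDiff ℝ (⊤:ℕ∞) (fun q : V3 × ℝ => σ q.1 q.2 i j))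
    (hσper : ∀ t i j, Periodic3 (fun x => σ x t i j))
    (hpde : ∀ x : V3, ∀ t ∈ Set.Icc (0:ℝ) T, ∀ i j,
      HasDerivWithinAt (fun s => σ x s i j)
        (ε * lap (fun y => σ y t i j) x
          - (∑ k, b x t k * pd k (fun y => σ y t i j) x)
          + (∑ k, pd k (fun y => b y t i) x * σ x t k j)
          + (∑ k, σ x t i k * pd k (fun y => b y t j) x)
          - γ * σ x t i j
          + δ * (if i = j then (1:ℝ) else 0))
        (Set.Icc (0:ℝ) T) t)
    (hσL2 : ∀ t ∈ Set.Icc (0:ℝ) T,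
      (∫ x in Set.Icc (0:V3) 1, ∑ i, ∑ j, (σ x t i j)^2) ≤ ρ t) :
    ∀ t ∈ Set.Icc (0:ℝ) T,
      (∫ x in Set.Icc (0:V3) 1, ∑ i, ∑ j, ∑ k, (pd k (fun y => σ y t i j) x)^2)
        ≤ Real.exp (2*M^2*t/ε)
          * ((∫ x in Set.Icc (0:V3) 1, ∑ i, ∑ j, ∑ k, (pd k (fun y => σ y 0 i j) x)^2)
             + (2*δ^2/ε) * t
             + ((2*γ^2 + 8*M^2)/ε) * ∫ s in (0:ℝ)..t, ρ s) := by
  have hslice : ∀ t i j, ContDiff ℝ (⊤ : ℕ∞) fun x => σ x t i j := fun t i j =>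
    (hσ i j).comp (contDiff_id.prodMk contDiff_const : ContDiff ℝ (⊤ : ℕ∞) fun x : V3 => (x, t))
  have hint : ∀ {f : V3 → ℝ}, Continuous f → IntegrableOn f (Set.Icc (0 : V3) 1) :=
    fun hf => hf.continuousOn.integrableOn_compact isCompact_Icc
  have hcpd : ∀ t i j, Continuous fun x => ∑ k, (pd k (fun y => σ y t i j) x) ^ 2 := fun t i j =>
    continuous_finsetSum _ fun k _ => (contDiff_pd (hslice t i j) k).continuous.pow 2
  have hclap : ∀ t i j, Continuous fun x => lap (fun y => σ y t i j) x := fun t i j =>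
    continuous_lap (hslice t i j)
  have hcDt : ∀ t i j, Continuous fun x : V3 =>
      fderiv ℝ (fun q : V3 × ℝ => σ q.1 q.2 i j) (x, t) (0, 1) := fun t i j =>
    (contDiff_fderiv_apply (hσ i j) (0, 1)).continuous.comp
      (by fun_prop : Continuous fun x : V3 => (x, t))
  have hcmul : ∀ t i j, Continuous fun x : V3 => lap (fun y => σ y t i j) x *
      fderiv ℝ (fun q : V3 × ℝ => σ q.1 q.2 i j) (x, t) (0, 1) := fun t i j =>
    (hclap t i j).mul (hcDt t i j)
  have hy : ∀ t, HasDerivAt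
      (fun s => ∫ x in Set.Icc (0 : V3) 1, ∑ i, ∑ j, ∑ k, (pd k (fun y => σ y s i j) x) ^ 2)
      (∫ x in Set.Icc (0 : V3) 1, -2 * ∑ i, ∑ j, lap (fun y => σ y t i j) x *
        fderiv ℝ (fun q : V3 × ℝ => σ q.1 q.2 i j) (x, t) (0, 1)) t := by
    intro t
    have h := HasDerivAt.fun_sum (u := Finset.univ) fun i _ => HasDerivAt.fun_sum (u := Finset.univ)
      fun j _ => hasDerivAt_dirichlet_energy (hσ i j) (fun t => hσper t i j) t
    have hl : (fun s => ∫ x in Set.Icc (0 : V3) 1, ∑ i, ∑ j, ∑ k, (pd k (fun y => σ y s i j) x) ^ 2) =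
        fun s => ∑ i, ∑ j, ∫ x in Set.Icc (0 : V3) 1, ∑ k, (pd k (fun y => σ y s i j) x) ^ 2 := by
      funext s
      rw [integral_finsetSum _ fun i _ => hint (continuous_finsetSum _ fun j _ => hcpd s i j)]
      exact Finset.sum_congr rfl fun i _ => integral_finsetSum _ fun j _ => hint (hcpd s i j)
    rw [hl, integral_const_mul, integral_finsetSum _ fun i _ => hint
      (continuous_finsetSum _ fun j _ => hcmul t i j), Finset.mul_sum]
    refine h.congr_deriv (Finset.sum_congr rfl fun i _ => ?_)
    rw [integral_finsetSum _ fun j _ => hint (hcmul t i j), Finset.mul_sum]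
  have hDt : ∀ t ∈ Set.Icc (0:ℝ) T, ∀ x i j,
      fderiv ℝ (fun q : V3 × ℝ => σ q.1 q.2 i j) (x, t) (0, 1) =
        ε * lap (fun y => σ y t i j) x
          - (∑ k, b x t k * pd k (fun y => σ y t i j) x)
          + (∑ k, pd k (fun y => b y t i) x * σ x t k j)
          + (∑ k, σ x t i k * pd k (fun y => b y t j) x)
          - γ * σ x t i j
          + δ * (if i = j then (1:ℝ) else 0) := by
    intro t ht x i j
    have h1 := ((hσ i j).differentiable (by simp) (x, t)).hasFDerivAt
    have h2 : HasDerivAt (fun s => σ x s i j) _ t :=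
      h1.comp_hasDerivAt t ((hasDerivAt_const t x).prodMk (hasDerivAt_id t))
    exact (uniqueDiffOn_Icc hT t ht).eq_deriv _ h2.hasDerivWithinAt (hpde x t ht i j)
  have hle : ∀ t ∈ Set.Icc (0:ℝ) T,
      (∫ x in Set.Icc (0 : V3) 1, -2 * ∑ i, ∑ j, lap (fun y => σ y t i j) x *
        fderiv ℝ (fun q : V3 × ℝ => σ q.1 q.2 i j) (x, t) (0, 1)) ≤
      2 * M ^ 2 / ε * (∫ x in Set.Icc (0 : V3) 1,
        ∑ i, ∑ j, ∑ k, (pd k (fun y => σ y t i j) x) ^ 2)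
      + (2 * γ ^ 2 + 8 * M ^ 2) / ε * ρ t := by
    intro t ht
    have hi1 := (hint (continuous_finsetSum Finset.univ fun i _ =>
      continuous_finsetSum Finset.univ fun j _ => hcpd t i j)).const_mul (2 * M ^ 2 / ε)
    have hi2 := (hint (continuous_finsetSum Finset.univ fun i _ =>
      continuous_finsetSum Finset.univ fun j _ => (hslice t i j).continuous.pow 2)).const_mul
        ((2 * γ ^ 2 + 8 * M ^ 2) / ε)
    have hi3 := (hint (continuous_finsetSum Finset.univ fun i _ => hclap t i i)).const_mul (2 * δ)
    have hmono := integral_mono (μ := volume.restrict (Set.Icc (0 : V3) 1))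
      ((hint (continuous_finsetSum Finset.univ fun i _ => continuous_finsetSum Finset.univ fun j _ =>
        hcmul t i j)).const_mul (-2)) ((hi1.add hi2).sub hi3)
      fun x => dissipation_bound ε γ δ M hε (b x t) (fun i j => pd j (fun y => b y t i) x) (σ x t)
        (fun i j => lap (fun y => σ y t i j) x) _ (fun i j k => pd k (fun y => σ y t i j) x)
        (hbbound x t) (hDt t ht x)
    refine hmono.trans ?_
    rw [integral_sub' (hi1.add hi2) hi3, integral_add' hi1 hi2, integral_const_mul,
      integral_const_mul, integral_const_mul, integral_finsetSum _ fun i _ => hint (hclap t i i),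
      Finset.sum_eq_zero fun i _ => integral_lap_eq_zero (hslice t i i) (hσper t i i),
      mul_zero, sub_zero]
    gcongr
    exact hσL2 t ht
  intro t ht
  refine (le_exp_mul_of_deriv_le (by positivity) (by positivity) hy hρc hρ0 hle t ht).trans ?_
  rw [div_mul_eq_mul_div]
  have h0 : 0 ≤ 2 * δ ^ 2 / ε * t := mul_nonneg (by positivity) ht.1
  gcongr
  linarith
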